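/- Let G be a connected bipartite distance hereditary graph with color classes X and Y, having at least one edge and no universal vertices. Then a nonempty set S ⊆ Y is the Y-shore of some maximal biclique of G with both shores nonempty if and only if S = N(x) for some x ∈ X or S = N(x) ∩ N(x') for some distinct x, x' ∈ X. -/

import Mathlib

open SimpleGraph

variable {V : Type*}

/-- `X`, `Y` form a bipartition of the simple graph `G`. -/
def IsBipartition (G : SimpleGraph V) (X Y : Set V) : Prop :=
  Disjoint X Y ∧ X ∪ Y = Set.univ ∧
    ∀ ⦃u v : V⦄, G.Adj u v → (u ∈ X ∧ v ∈ Y) ∨ (u ∈ Y ∧ v ∈ X)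

/-- `G` is distance hereditary. -/
def DistHereditary (G : SimpleGraph V) : Prop :=
  ∀ (S : Set V) (u v : S), (G.induce S).Reachable u v →
    (G.induce S).dist u v = G.dist ↑u ↑v

def IsBiclique (G : SimpleGraph V) (X Y A B : Set V) : Prop :=
  A ⊆ X ∧ B ⊆ Y ∧ ∀ a ∈ A, ∀ b ∈ B, G.Adj a b

def IsMaxBiclique (G : SimpleGraph V) (X Y A B : Set V) : Prop :=
  IsBiclique G X Y A B ∧
    ∀ A' B', IsBiclique G X Y A' B' → A ⊆ A' → B ⊆ B' → A = A' ∧ B = B'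

/-- The maximal bicliques of `G` with both shores nonempty. -/
def MaxBicliques (G : SimpleGraph V) (X Y : Set V) : Set (Set V × Set V) :=
  {p | IsMaxBiclique G X Y p.1 p.2 ∧ p.1.Nonempty ∧ p.2.Nonempty}

/-- `q` covers `p` in the poset of maximal bicliques with nonempty shores,
ordered by inclusion of `X`-shores. -/
def Covers (G : SimpleGraph V) (X Y : Set V) (p q : Set V × Set V) : Prop :=
  p ∈ MaxBicliques G X Y ∧ q ∈ MaxBicliques G X Y ∧ p.1 ⊂ q.1 ∧
    ∀ r ∈ MaxBicliques G X Y, ¬ (p.1 ⊂ r.1 ∧ r.1 ⊂ q.1)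

/-- The Hasse graph of the poset of maximal bicliques with nonempty shores. -/
def HasseGraph (G : SimpleGraph V) (X Y : Set V) :
    SimpleGraph (MaxBicliques G X Y) :=
  SimpleGraph.fromRel (fun p q => Covers G X Y p.val q.val)

def NoUniversalVertex (G : SimpleGraph V) (X Y : Set V) : Prop :=
  (∀ x ∈ X, ∃ y ∈ Y, ¬ G.Adj x y) ∧ (∀ y ∈ Y, ∃ x ∈ X, ¬ G.Adj y x)

def deleteVert (G : SimpleGraph V) (v : V) : SimpleGraph V :=
  SimpleGraph.fromRel (fun a b => G.Adj a b ∧ a ≠ v ∧ b ≠ v)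

def domino : SimpleGraph (Fin 6) :=
  SimpleGraph.fromRel (fun i j => j = i + 1 ∨ (i = 0 ∧ j = 3))

def DominoFree (G : SimpleGraph V) : Prop :=
  ¬ ∃ f : Fin 6 → V, Function.Injective f ∧
      ∀ i j, domino.Adj i j ↔ G.Adj (f i) (f j)

def cycleGraph' (n : ℕ) : SimpleGraph (ZMod n) :=
  SimpleGraph.fromRel (fun i j => j = i + 1)

def HasInducedCycle (G : SimpleGraph V) (n : ℕ) : Prop :=
  ∃ f : ZMod n → V, Function.Injective f ∧
      ∀ i j, (cycleGraph' n).Adj i j ↔ G.Adj (f i) (f j)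

def Chordal (G : SimpleGraph V) : Prop := ∀ n, 4 ≤ n → ¬ HasInducedCycle G n

def Ptolemaic (G : SimpleGraph V) : Prop := Chordal G ∧ DistHereditary G

def MaxCliques (G : SimpleGraph V) : Set (Set V) :=
  {S | G.IsClique S ∧ ∀ T, G.IsClique T → S ⊆ T → S = T}

def cliqueIncidence (G : SimpleGraph V) :
    SimpleGraph (V ⊕ ↥(MaxCliques G)) :=
  SimpleGraph.fromRel (fun a b =>
    match a, b with
    | Sum.inl v, Sum.inr K => v ∈ K.val
    | _, _ => False)

def incidenceY (G : SimpleGraph V) (X Y : Set V) :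
    SimpleGraph (↥Y ⊕ ↥(MaxBicliques G X Y)) :=
  SimpleGraph.fromRel (fun a b =>
    match a, b with
    | Sum.inl y, Sum.inr B => (y : V) ∈ B.val.2
    | _, _ => False)

def incidenceX (G : SimpleGraph V) (X Y : Set V) :
    SimpleGraph (↥X ⊕ ↥(MaxBicliques G X Y)) :=
  SimpleGraph.fromRel (fun a b =>
    match a, b with
    | Sum.inl x, Sum.inr B => (x : V) ∈ B.val.1
    | _, _ => False)

def starGraph (G : SimpleGraph V) (v v' : V) : SimpleGraph (Option V) :=
  SimpleGraph.fromRel (fun a b =>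
    match a, b with
    | some a, some b => G.Adj a b
    | none, some b => G.Adj v b ∧ G.Adj v' b
    | _, _ => False)

/-- Two vertices of the same color class are not adjacent. -/
theorem IsBipartition.not_adj_left {G : SimpleGraph V} {X Y : Set V}
    (hbip : IsBipartition G X Y) {u v : V} (hu : u ∈ X) (hv : v ∈ X) : ¬ G.Adj u v := by
  intro h
  rcases hbip.2.2 h with h | h
  · exact Set.disjoint_left.1 hbip.1 hv h.2
  · exact Set.disjoint_left.1 hbip.1 hu h.1

/-- In a bipartite graph, the neighborhood of a vertex of `X` is contained in `Y`. -/
theorem IsBipartition.neighborSet_subset {G : SimpleGraph V} {X Y : Set V}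
    (hbip : IsBipartition G X Y) {x : V} (hx : x ∈ X) : G.neighborSet x ⊆ Y := by
  intro y hy
  rcases hbip.2.2 hy with h | h
  · exact h.2
  · exact absurd h.1 (Set.disjoint_left.1 hbip.1 hx)

/-- Two distinct nonadjacent vertices at distance at most two have a common neighbor. -/
theorem SimpleGraph.Reachable.exists_common_adj {W : Type*} {H : SimpleGraph W} {u v : W}
    (h : H.Reachable u v) (hne : u ≠ v) (hadj : ¬ H.Adj u v) (hdist : H.dist u v ≤ 2) :
    ∃ m, H.Adj u m ∧ H.Adj m v := by
  obtain ⟨w, hw⟩ := h.exists_walk_length_eq_dist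
  cases w with
  | nil => exact absurd rfl hne
  | cons h₁ w =>
    cases w with
    | nil => exact absurd h₁ hadj
    | cons h₂ w =>
      cases w with
      | nil => exact ⟨_, h₁, h₂⟩
      | cons h₃ w =>
        simp only [Walk.length_cons] at hw
        omega

/-- A bipartite distance hereditary graph has no induced cycle of length six. -/
theorem DistHereditary.not_inducedHexagon {G : SimpleGraph V} {X Y : Set V}
    (hbip : IsBipartition G X Y) (hDH : DistHereditary G) {a b c p q r : V}
    (ha : a ∈ X) (hb : b ∈ X) (hc : c ∈ X)
    (hap : G.Adj a p) (hbp : G.Adj b p) (hcp : ¬ G.Adj c p)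
    (hbq : G.Adj b q) (hcq : G.Adj c q) (haq : ¬ G.Adj a q)
    (har : G.Adj a r) (hcr : G.Adj c r) : False := by
  let T : Set V := {a, p, b, q, c}
  let a' : T := ⟨a, by simp [T]⟩
  let p' : T := ⟨p, by simp [T]⟩
  let b' : T := ⟨b, by simp [T]⟩
  let q' : T := ⟨q, by simp [T]⟩
  let c' : T := ⟨c, by simp [T]⟩
  have h₁ : (G.induce T).Adj a' p' := hap
  have h₂ : (G.induce T).Adj p' b' := hbp.symm
  have h₃ : (G.induce T).Adj b' q' := hbq
  have h₄ : (G.induce T).Adj q' c' := hcq.symm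
  have hreach : (G.induce T).Reachable a' c' :=
    h₁.reachable.trans (h₂.reachable.trans (h₃.reachable.trans h₄.reachable))
  have hdist : (G.induce T).dist a' c' ≤ 2 := by
    rw [hDH T a' c' hreach]
    exact dist_le (Walk.cons har (Walk.cons hcr.symm Walk.nil))
  have hne : a' ≠ c' := by
    intro h
    have hac : a = c := congrArg Subtype.val h
    exact hcp (hac ▸ hap)
  obtain ⟨⟨m, hm⟩, ham, hmc⟩ :=
    hreach.exists_common_adj hne (fun h => hbip.not_adj_left ha hc h) hdist
  replace ham : G.Adj a m := ham
  replace hmc : G.Adj m c := hmc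
  rcases hm with rfl | rfl | rfl | rfl | rfl
  · exact G.irrefl ham
  · exact hcp hmc.symm
  · exact hbip.not_adj_left ha hb ham
  · exact haq ham
  · exact G.irrefl hmc

/-- Among the neighborhoods of three vertices in one color class of a bipartite distance
hereditary graph, two have their intersection contained in the third. -/
theorem DistHereditary.inter_neighborSet_subset {G : SimpleGraph V} {X Y : Set V}
    (hbip : IsBipartition G X Y) (hDH : DistHereditary G) {a b c : V}
    (ha : a ∈ X) (hb : b ∈ X) (hc : c ∈ X) :
    G.neighborSet a ∩ G.neighborSet b ⊆ G.neighborSet c ∨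
      G.neighborSet b ∩ G.neighborSet c ⊆ G.neighborSet a ∨
      G.neighborSet a ∩ G.neighborSet c ⊆ G.neighborSet b := by
  by_contra! h
  obtain ⟨h₁, h₂, h₃⟩ := h
  obtain ⟨p, ⟨hap, hbp⟩, hcp⟩ := Set.not_subset.1 h₁
  obtain ⟨q, ⟨hbq, hcq⟩, haq⟩ := Set.not_subset.1 h₂
  obtain ⟨r, ⟨har, hcr⟩, -⟩ := Set.not_subset.1 h₃
  exact hDH.not_inducedHexagon hbip ha hb hc hap hbp hcp hbq hcq haq har hcr

/-- In a bipartite distance hereditary graph, every nonempty finite set of vertices of one color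
class has two (possibly equal) members whose common neighbors are adjacent to all of it. -/
theorem DistHereditary.exists_inter_neighborSet_subset {G : SimpleGraph V} {X Y : Set V}
    (hbip : IsBipartition G X Y) (hDH : DistHereditary G) {A : Set V} (hfin : A.Finite)
    (hA : A.Nonempty) (hAX : A ⊆ X) :
    ∃ x ∈ A, ∃ x' ∈ A, ∀ a ∈ A, G.neighborSet x ∩ G.neighborSet x' ⊆ G.neighborSet a := by
  revert hA hAX
  induction A, hfin using Set.Finite.induction_on with
  | empty => exact fun h => absurd h Set.not_nonempty_empty
  | @insert c A _ _ ih =>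
    intro _ hAX
    have hcA : c ∈ insert c A := Set.mem_insert c A
    have hsub : A ⊆ insert c A := Set.subset_insert c A
    rcases A.eq_empty_or_nonempty with rfl | hne
    · refine ⟨c, hcA, c, hcA, ?_⟩
      rintro a (rfl | h)
      · exact Set.inter_subset_left
      · exact absurd h (Set.notMem_empty a)
    · obtain ⟨x, hx, x', hx', h⟩ := ih hne (hsub.trans hAX)
      rcases hDH.inter_neighborSet_subset hbip (hAX (hsub hx)) (hAX (hsub hx')) (hAX hcA)
        with hc | hc | hc
      · refine ⟨x, hsub hx, x', hsub hx', ?_⟩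
        rintro a (rfl | ha)
        · exact hc
        · exact h a ha
      · refine ⟨x', hsub hx', c, hcA, ?_⟩
        rintro a (rfl | ha)
        · exact Set.inter_subset_right
        · exact fun y hy => h a ha ⟨hc hy, hy.1⟩
      · refine ⟨x, hsub hx, c, hcA, ?_⟩
        rintro a (rfl | ha)
        · exact Set.inter_subset_right
        · exact fun y hy => h a ha ⟨hy.1, hc hy⟩

/-- A nonempty intersection of two neighborhoods of vertices of `X` is the `Y`-shore of a maximal
biclique. -/
theorem IsBipartition.exists_mem_maxBicliques {G : SimpleGraph V} {X Y : Set V}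
    (hbip : IsBipartition G X Y) {x x' : V} (hx : x ∈ X) (hx' : x' ∈ X)
    (hne : (G.neighborSet x ∩ G.neighborSet x').Nonempty) :
    ∃ A : Set V, (A, G.neighborSet x ∩ G.neighborSet x') ∈ MaxBicliques G X Y := by
  refine ⟨{a | a ∈ X ∧ ∀ y ∈ G.neighborSet x ∩ G.neighborSet x', G.Adj a y},
    ⟨⟨fun a ha => ha.1, fun y hy => hbip.neighborSet_subset hx hy.1, fun a ha => ha.2⟩, ?_⟩,
    ⟨x, hx, fun y hy => hy.1⟩, hne⟩
  rintro A' B' ⟨hA', -, hadj⟩ hAA hBB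
  refine ⟨hAA.antisymm fun a ha => ⟨hA' ha, fun y hy => hadj a ha y (hBB hy)⟩,
    hBB.antisymm fun y hy => ⟨hadj x (hAA ⟨hx, fun z hz => hz.1⟩) y hy,
      hadj x' (hAA ⟨hx', fun z hz => hz.2⟩) y hy⟩⟩

/-- In a connected BDH graph with an edge and no universal
vertices, a nonempty `S ⊆ Y` is the `Y`-shore of a maximal biclique with
nonempty shores iff `S = N(x)` or `S = N(x) ∩ N(x')` for some `x ≠ x'` in `X`. -/
theorem yShore_iff_neighborhood_intersection [Fintype V] (G : SimpleGraph V)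
    (X Y : Set V) (hbip : IsBipartition G X Y) (hDH : DistHereditary G)
    (hconn : G.Connected) (hedge : ∃ u v, G.Adj u v)
    (huniv : NoUniversalVertex G X Y) (S : Set V) (hS : S.Nonempty) (hSY : S ⊆ Y) :
    (∃ A : Set V, (A, S) ∈ MaxBicliques G X Y) ↔
      ((∃ x ∈ X, S = G.neighborSet x) ∨
        (∃ x ∈ X, ∃ x' ∈ X, x ≠ x' ∧ S = G.neighborSet x ∩ G.neighborSet x')) := by
  constructor
  · rintro ⟨A, ⟨⟨hAX, -, hadj⟩, hmax⟩, hA, -⟩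
    obtain ⟨x, hx, x', hx', h⟩ :=
      hDH.exists_inter_neighborSet_subset hbip A.toFinite hA hAX
    have hbic : IsBiclique G X Y A (G.neighborSet x ∩ G.neighborSet x') :=
      ⟨hAX, fun y hy => hbip.neighborSet_subset (hAX hx) hy.1, fun a ha y hy => h a ha hy⟩
    have heq : S = G.neighborSet x ∩ G.neighborSet x' :=
      (hmax A _ hbic subset_rfl fun y hy => ⟨hadj x hx y hy, hadj x' hx' y hy⟩).2
    by_cases hxx : x = x'
    · subst hxx
      exact Or.inl ⟨x, hAX hx, heq.trans (Set.inter_self _)⟩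
    · exact Or.inr ⟨x, hAX hx, x', hAX hx', hxx, heq⟩
  · rintro (⟨x, hx, rfl⟩ | ⟨x, hx, x', hx', -, rfl⟩)
    · rw [← Set.inter_self (G.neighborSet x)] at hS ⊢
      exact hbip.exists_mem_maxBicliques hx hx hS
    · exact hbip.exists_mem_maxBicliques hx hx' hS
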